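/- (Augmentation Lemma) Let G be a graph on vertices {1,…,n} and A ∈ S(G). Suppose A has the Strong Spectral Property and λ is an eigenvalue of A with multiplicity k ≥ 1. Suppose α ⊆ {1,…,n} has cardinality k+1 and has the property that every eigenvector x of A corresponding to λ (i.e., every nonzero x with Ax = λx) satisfies |supp(x) ∩ α| ≥ 2. Let H be the graph on vertices {1,…,n+1} obtained from G by appending the vertex n+1 adjacent exactly to the vertices in α. Then there exists a matrix A' ∈ S(H) such that A' has the Strong Spectral Property, the multiplicity of λ as an eigenvalue of A' is k+1, and all other eigenvalues of A' and their multiplicities are exactly those of A (i.e., spec(A') equals spec(A) together with one extra copy of λ). -/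

import Mathlib

open Matrix

/-- The geometric multiplicity of `lam` as an eigenvalue of `A`:
`dim ker (A - lam • I)`. -/
noncomputable def multOf {m : Type*} [Fintype m] [DecidableEq m]
    (A : Matrix m m ℝ) (lam : ℝ) : ℕ :=
  Module.finrank ℝ (LinearMap.ker (A - lam • (1 : Matrix m m ℝ)).mulVecLin)

/-- The Strong Spectral Property. -/
def HasSSP {m : Type*} [Fintype m] [DecidableEq m] (A : Matrix m m ℝ) : Prop :=
  ∀ X : Matrix m m ℝ, X.IsSymm → Matrix.hadamard A X = 0 →
    Matrix.hadamard (1 : Matrix m m ℝ) X = 0 → A * X - X * A = 0 → X = 0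

/-- `A ∈ S(G)`: `A` is symmetric and its off-diagonal nonzero pattern is given by `G`. -/
def InS {m : Type*} [Fintype m] [DecidableEq m]
    (G : SimpleGraph m) (A : Matrix m m ℝ) : Prop :=
  A.IsSymm ∧ ∀ i j, i ≠ j → (A i j ≠ 0 ↔ G.Adj i j)


/-- The graph on `{0, …, n}` obtained from `G` (on `{0, …, n-1}`) by appending
the new vertex `n` adjacent exactly to the vertices in `α`. -/
def augment {n : ℕ} (G : SimpleGraph (Fin n)) (α : Finset (Fin n)) :
    SimpleGraph (Fin (n + 1)) :=
  SimpleGraph.fromRel fun u v =>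
    (∃ i j : Fin n, u = i.castSucc ∧ v = j.castSucc ∧ G.Adj i j) ∨
    (∃ i : Fin n, i ∈ α ∧ u = Fin.last n ∧ v = i.castSucc)

open Filter Topology

/-- Solutions of `T v = 0` deform to solutions of `T v + t • g (t, v) = 0` with `t ≠ 0` small,
provided that `T` is onto. -/
theorem exists_ne_zero_perturbed_solution {E F : Type*} [NormedAddCommGroup E] [NormedSpace ℝ E]
    [CompleteSpace E] [NormedAddCommGroup F] [NormedSpace ℝ F] [CompleteSpace F]
    (T : E →L[ℝ] F) (hT : Function.Surjective T) (g : ℝ × E → F) (v₀ : E)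
    (hg : ContDiffAt ℝ 1 g (0, v₀)) (h₀ : T v₀ = 0) {p : ℝ × E → Prop}
    (hp : ∀ᶠ z in 𝓝 ((0 : ℝ), v₀), p z) :
    ∃ t v, t ≠ 0 ∧ p (t, v) ∧ T v + t • g (t, v) = 0 := by
  have hg' := hg.hasStrictFDerivAt one_ne_zero
  set g' := fderiv ℝ g (0, v₀)
  have hΨ : HasStrictFDerivAt (fun z : ℝ × E => (z.1, T z.2 + z.1 • g z)) _ (0, v₀) :=
    hasStrictFDerivAt_fst.prodMk
      ((T.hasStrictFDerivAt.comp _ hasStrictFDerivAt_snd).add (hasStrictFDerivAt_fst.smul hg'))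
  have hmap := hΨ.map_nhds_eq_of_surj (by
    rw [LinearMap.range_eq_top]
    rintro ⟨s, y⟩
    obtain ⟨w, hw⟩ := hT (y - s • g (0, v₀))
    exact ⟨(s, w), by simp [hw]⟩)
  have himg := image_mem_map (m := fun z : ℝ × E => (z.1, T z.2 + z.1 • g z)) hp
  rw [hmap] at himg
  simp only [h₀, zero_smul, add_zero] at himg
  have hline : Tendsto (fun t : ℝ => (t, (0 : F))) (𝓝[≠] 0) (𝓝 (0, 0)) :=
    (Continuous.tendsto (by fun_prop) 0).mono_left nhdsWithin_le_nhds
  obtain ⟨t, ⟨⟨s, v⟩, hv, hst⟩, ht⟩ :=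
    ((hline.eventually himg).and self_mem_nhdsWithin).exists
  obtain ⟨rfl, hs⟩ := Prod.mk.inj hst
  exact ⟨s, v, ht, hv, hs⟩

/-- The two sides of a Cayley transform identity are similar. -/
theorem exists_isUnit_mul_eq_mul {R : Type*} [Ring R] {a b c : R} (hpos : IsUnit (1 + c))
    (hneg : IsUnit (1 - c)) (h : (1 + c) * a * (1 - c) = (1 - c) * b * (1 + c)) :
    ∃ q : R, IsUnit q ∧ a * q = q * b := by
  obtain ⟨u, hu⟩ := hpos
  have hcomm : ↑u⁻¹ * (1 - c) = (1 - c) * ↑u⁻¹ := by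
    rw [Units.inv_mul_eq_iff_eq_mul, ← mul_assoc, Units.eq_mul_inv_iff_mul_eq, hu]
    noncomm_ring
  refine ⟨↑u⁻¹ * (1 - c), u⁻¹.isUnit.mul hneg, ?_⟩
  rw [← hu] at h
  rw [mul_assoc, Units.eq_inv_mul_iff_mul_eq, hcomm, ← mul_assoc, ← mul_assoc,
    Units.mul_inv_eq_iff_eq_mul, h]

section Matrix

variable {m : Type*} [Fintype m] [DecidableEq m]

theorem exists_trace_mul_eq (f : Matrix m m ℝ →ₗ[ℝ] ℝ) :
    ∃ X : Matrix m m ℝ, ∀ Y, f Y = (X * Y).trace := by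
  refine ⟨Matrix.of fun i j => f (Matrix.single j i 1), fun Y => ?_⟩
  conv_lhs => rw [Matrix.matrix_eq_sum_single Y]
  simp only [map_sum, Matrix.trace, Matrix.diag, Matrix.mul_apply, Matrix.of_apply]
  rw [Finset.sum_comm]
  refine Finset.sum_congr rfl fun i _ => Finset.sum_congr rfl fun j _ => ?_
  have : Matrix.single j i (Y j i) = Y j i • Matrix.single j i (1 : ℝ) := by simp
  rw [this, map_smul, smul_eq_mul, mul_comm]

theorem multOf_add_rank (A : Matrix m m ℝ) (t : ℝ) :
    (A - t • (1 : Matrix m m ℝ)).rank + multOf A t = Fintype.card m := by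
  have := (A - t • (1 : Matrix m m ℝ)).mulVecLin.finrank_range_add_finrank_ker
  rwa [Module.finrank_fintype_fun_eq_card] at this

theorem multOf_eq_of_mul_eq_mul {A B Q : Matrix m m ℝ} (hQ : IsUnit Q.det)
    (h : A * Q = Q * B) (t : ℝ) : multOf A t = multOf B t := by
  have hr : (A - t • (1 : Matrix m m ℝ)).rank = (B - t • (1 : Matrix m m ℝ)).rank := by
    rw [← Matrix.rank_mul_eq_left_of_isUnit_det Q _ hQ,
      ← Matrix.rank_mul_eq_right_of_isUnit_det Q (B - t • 1) hQ]
    congr 1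
    simp [sub_mul, mul_sub, h]
  have hA := multOf_add_rank A t
  have hB := multOf_add_rank B t
  omega

theorem isUnit_one_add_of_transpose_eq_neg {K : Matrix m m ℝ} (hK : Kᵀ = -K) :
    IsUnit (1 + K) := by
  rw [← Matrix.mulVec_injective_iff_isUnit]
  refine (injective_iff_map_eq_zero (Matrix.mulVecLin (1 + K))).2 fun x hx => ?_
  have hx : x + K *ᵥ x = 0 := by simpa [Matrix.add_mulVec] using hx
  have hskew : x ⬝ᵥ K *ᵥ x = -(x ⬝ᵥ K *ᵥ x) := by
    conv_lhs => rw [Matrix.dotProduct_mulVec, ← Matrix.mulVec_transpose, hK, Matrix.neg_mulVec,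
      neg_dotProduct, dotProduct_comm]
  have hdot : x ⬝ᵥ x + x ⬝ᵥ K *ᵥ x = 0 := by rw [← dotProduct_add, hx, dotProduct_zero]
  exact dotProduct_self_eq_zero.1 (by linarith)

/-- The `0`-`1` matrix marking the diagonal and the edges of `H`. -/
noncomputable def closedAdj (H : SimpleGraph m) : Matrix m m ℝ :=
  open Classical in Matrix.of fun i j => if i = j ∨ H.Adj i j then 1 else 0

omit [Fintype m] in
theorem closedAdj_isSymm (H : SimpleGraph m) : (closedAdj H).IsSymm := by
  ext i j
  classical
  exact if_congr (or_congr eq_comm (H.adj_comm j i)) rfl rfl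

omit [Fintype m] in
theorem hadamard_closedAdj_eq_zero_iff {H : SimpleGraph m} {X : Matrix m m ℝ} :
    closedAdj H ⊙ X = 0 ↔ (∀ i j, H.Adj i j → X i j = 0) ∧ ∀ i, X i i = 0 := by
  rw [← Matrix.ext_iff]
  simp only [closedAdj, Matrix.hadamard_apply, Matrix.of_apply, Matrix.zero_apply, ite_mul,
    one_mul, zero_mul, ite_eq_right_iff]
  constructor
  · exact fun h => ⟨fun i j hij => h i j (Or.inr hij), fun i => h i i (Or.inl rfl)⟩
  · rintro ⟨h, h'⟩ i j (rfl | hij)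
    exacts [h' i, h i j hij]

omit [Fintype m] in
theorem hadamard_closedAdj_eq_self {H : SimpleGraph m} {X : Matrix m m ℝ}
    (hX : ∀ i j, i ≠ j → X i j ≠ 0 → H.Adj i j) : closedAdj H ⊙ X = X := by
  ext i j
  simp only [closedAdj, Matrix.hadamard_apply, Matrix.of_apply]
  have := hX i j
  split_ifs with h <;> simp
  grind

attribute [local instance] Matrix.linftyOpNormedRing Matrix.linftyOpNormedAlgebra

omit [DecidableEq m] in
theorem continuous_matrix_entry (i j : m) : Continuous fun X : Matrix m m ℝ => X i j :=
  LinearMap.continuous_of_finiteDimensional (Matrix.entryLinearMap ℝ ℝ i j)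

/-- The Strong Spectral Property relative to a fixed pattern `H` is an open condition. -/
theorem eventually_hasSSP {H : SimpleGraph m} {M : Matrix m m ℝ}
    (hM : ∀ X : Matrix m m ℝ, X.IsSymm → closedAdj H ⊙ X = 0 → M * X = X * M → X = 0) :
    ∀ᶠ B in 𝓝 M, InS H B → HasSSP B := by
  let S : Matrix m m ℝ →L[ℝ] Matrix m m ℝ := LinearMap.toContinuousLinearMap
    (LinearMap.id - (Matrix.transposeLinearEquiv m m ℝ ℝ).toLinearMap)
  let D : Matrix m m ℝ →L[ℝ] Matrix m m ℝ := LinearMap.toContinuousLinearMap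
    { toFun := fun X => closedAdj H ⊙ X
      map_add' := fun X Y => Matrix.hadamard_add _ _ _
      map_smul' := fun c X => Matrix.hadamard_smul _ _ _ }
  let Φ : Matrix m m ℝ → (Matrix m m ℝ →L[ℝ] Matrix m m ℝ × Matrix m m ℝ × Matrix m m ℝ) :=
    fun B => (ContinuousLinearMap.mul ℝ (Matrix m m ℝ) B -
      (ContinuousLinearMap.mul ℝ (Matrix m m ℝ)).flip B).prod (D.prod S)
  have hΦ : ∀ B X, Φ B X = (B * X - X * B, closedAdj H ⊙ X, X - Xᵀ) := fun B X => rfl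
  have hcont : Continuous Φ := by
    refine (ContinuousLinearMap.prodₗᵢ ℝ).continuous.comp (.prodMk ?_ continuous_const)
    fun_prop
  have hinj : Function.Injective (Φ M) := by
    refine (injective_iff_map_eq_zero _).2 fun X hX => ?_
    rw [hΦ, Prod.mk_eq_zero, Prod.mk_eq_zero, sub_eq_zero, sub_eq_zero] at hX
    exact hM X hX.2.2.symm hX.2.1 hX.1
  filter_upwards [hcont.continuousAt.eventually
    (ContinuousLinearMap.isOpen_injective.mem_nhds hinj)] with B hB hBH X hX hBX hIX hcomm
  refine (injective_iff_map_eq_zero _).1 hB X ((hΦ B X).trans ?_)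
  rw [hcomm, hX.eq, sub_self, hadamard_closedAdj_eq_zero_iff.2]
  · rfl
  · refine ⟨fun i j hij => ?_, fun i => ?_⟩
    · exact (mul_eq_zero.1 (congrFun₂ hBX i j)).resolve_left ((hBH.2 i j hij.ne).2 hij)
    · simpa using congrFun₂ hIX i i

theorem surjective_tangent_add_pattern {H : SimpleGraph m} {M : Matrix m m ℝ} (hM : M.IsSymm)
    (hstrong : ∀ X : Matrix m m ℝ, X.IsSymm → closedAdj H ⊙ X = 0 → M * X = X * M → X = 0)
    (T : Matrix m m ℝ × Matrix m m ℝ × Matrix m m ℝ →ₗ[ℝ] Matrix m m ℝ)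
    (hT : ∀ L R S, T (L, R, S) = closedAdj H ⊙ (R + Rᵀ) +
      ((L - Lᵀ) * M - M * (L - Lᵀ)) + (S - Sᵀ)) :
    Function.Surjective T := by
  rw [← LinearMap.range_eq_top]
  by_contra hne
  obtain ⟨f, hf, hker⟩ := Submodule.exists_le_ker_of_lt_top _ (lt_top_iff_ne_top.2 hne)
  obtain ⟨X, hX⟩ := exists_trace_mul_eq f
  have hzero : ∀ L R S, (X * T (L, R, S)).trace = 0 := fun L R S => by
    rw [← hX]; exact hker ⟨_, rfl⟩
  have hsymm : X.IsSymm := by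
    rw [Matrix.IsSymm, Matrix.ext_iff_trace_mul_right]
    intro S
    have h := hzero 0 0 S
    simp only [hT, add_zero, Matrix.transpose_zero, Matrix.hadamard_zero, sub_zero, zero_mul,
      mul_zero, zero_add, mul_sub, Matrix.trace_sub] at h
    rw [← Matrix.trace_transpose, Matrix.transpose_mul, Matrix.transpose_transpose,
      Matrix.trace_mul_comm]
    linarith
  have hpat : closedAdj H ⊙ X = 0 := by
    have h := hzero 0 X 0
    simp only [hT, hsymm.eq, Matrix.transpose_zero, sub_zero, zero_mul, mul_zero, add_zero] at h
    have hsym' : (closedAdj H ⊙ (X + X))ᵀ = closedAdj H ⊙ (X + X) := by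
      ext i j
      simp [Matrix.hadamard_apply, hsymm.apply, (closedAdj_isSymm H).apply]
    rw [← hsym', ← Matrix.sum_hadamard_eq] at h
    have hnn : ∀ i j, 0 ≤ (X ⊙ (closedAdj H ⊙ (X + X))) i j := fun i j => by
      simp only [closedAdj, Matrix.hadamard_apply, Matrix.of_apply, Matrix.add_apply]
      split_ifs <;> nlinarith [mul_self_nonneg (X i j)]
    ext i j
    have hij := (Finset.sum_eq_zero_iff_of_nonneg fun j _ => hnn i j).1
      ((Finset.sum_eq_zero_iff_of_nonneg fun i _ => Finset.sum_nonneg fun j _ => hnn i j).1 h i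
        (Finset.mem_univ i)) j (Finset.mem_univ j)
    simp only [closedAdj, Matrix.hadamard_apply, Matrix.of_apply, Matrix.add_apply] at hij ⊢
    split_ifs at hij ⊢ with hc
    · simpa using hij
    · simp
  have hcomm : M * X = X * M := by
    refine (sub_eq_zero.1 (Matrix.ext_iff_trace_mul_right.2 fun L => ?_))
    have h := hzero L 0 0
    simp only [hT, Matrix.transpose_zero, add_zero, Matrix.hadamard_zero, sub_zero, zero_add,
      mul_sub, sub_mul, Matrix.trace_sub] at h
    have e₁ : (X * (L * M)).trace = (M * X * L).trace := by
      rw [← mul_assoc, Matrix.trace_mul_cycle]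
    have e₂ : (X * (Lᵀ * M)).trace = (X * M * L).trace := by
      rw [← Matrix.trace_transpose]
      simp only [Matrix.transpose_mul, Matrix.transpose_transpose, hM.eq, hsymm.eq]
      rw [Matrix.trace_mul_cycle]
    have e₃ : (X * (M * Lᵀ)).trace = (M * X * L).trace := by
      rw [← Matrix.trace_transpose]
      simp only [Matrix.transpose_mul, Matrix.transpose_transpose, hM.eq, hsymm.eq]
      rw [Matrix.trace_mul_cycle, Matrix.trace_mul_cycle]
    rw [zero_mul, Matrix.trace_zero, sub_mul, Matrix.trace_sub]
    rw [e₁, e₂, e₃, ← mul_assoc] at h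
    linarith
  refine hf (LinearMap.ext fun Y => ?_)
  rw [hX, hstrong X hsymm hpat hcomm]
  simp

/-- Matrix Liberation Lemma: if `M` has the Strong Spectral Property relative to `H`, and `H` is
the union of the patterns of `M` and of a tangent vector `K * M - M * K` to its isospectral
manifold, then `M` is similar to a matrix in `S(H)` with the Strong Spectral Property. -/
theorem exists_similar_hasSSP {H : SimpleGraph m} {M K : Matrix m m ℝ} (hM : M.IsSymm)
    (hMH : ∀ i j, i ≠ j → M i j ≠ 0 → H.Adj i j)
    (hstrong : ∀ X : Matrix m m ℝ, X.IsSymm → closedAdj H ⊙ X = 0 → M * X = X * M → X = 0)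
    (hK : Kᵀ = -K) (hKH : ∀ i j, i ≠ j → (K * M - M * K) i j ≠ 0 → H.Adj i j)
    (hadj : ∀ i j, H.Adj i j → M i j ≠ 0 ∨ (K * M - M * K) i j ≠ 0) :
    ∃ A Q : Matrix m m ℝ, InS H A ∧ HasSSP A ∧ IsUnit Q.det ∧ A * Q = Q * M := by
  set N := K * M - M * K with hN
  have hNsymm : Nᵀ = N := by
    simp only [hN, Matrix.transpose_sub, Matrix.transpose_mul, hK, hM.eq]
    noncomm_ring
  let T : Matrix m m ℝ × Matrix m m ℝ × Matrix m m ℝ →ₗ[ℝ] Matrix m m ℝ :=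
    { toFun := fun v => closedAdj H ⊙ (v.2.1 + v.2.1ᵀ) +
        ((v.1 - v.1ᵀ) * M - M * (v.1 - v.1ᵀ)) + (v.2.2 - v.2.2ᵀ)
      map_add' := fun v w => by
        simp only [Prod.fst_add, Prod.snd_add, Matrix.transpose_add, Matrix.hadamard_add, mul_add,
          add_mul, mul_sub, sub_mul]
        abel
      map_smul' := fun c v => by
        simp only [Prod.smul_fst, Prod.smul_snd, Matrix.transpose_smul, Matrix.hadamard_add,
          Matrix.hadamard_smul, mul_sub, sub_mul, smul_mul_assoc, mul_smul_comm, smul_add,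
          smul_sub, RingHom.id_apply] }
  have hT := surjective_tangent_add_pattern hM hstrong T fun _ _ _ => rfl
  let skew : Matrix m m ℝ →L[ℝ] Matrix m m ℝ := LinearMap.toContinuousLinearMap
    (LinearMap.id - (Matrix.transposeLinearEquiv m m ℝ ℝ).toLinearMap)
  let pat : Matrix m m ℝ →L[ℝ] Matrix m m ℝ := LinearMap.toContinuousLinearMap
    { toFun := fun R => closedAdj H ⊙ (R + Rᵀ)
      map_add' := fun X Y => by
        simp only [Matrix.transpose_add, Matrix.hadamard_add]
        abel
      map_smul' := fun c X => by
        simp only [Matrix.transpose_smul, Matrix.hadamard_add, Matrix.hadamard_smul, smul_add,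
          RingHom.id_apply] }
  have hskew : ∀ L, skew L = L - Lᵀ := fun L => rfl
  have hpat : ∀ R, pat R = closedAdj H ⊙ (R + Rᵀ) := fun R => rfl
  let v₀ : Matrix m m ℝ × Matrix m m ℝ × Matrix m m ℝ := (-(1 / 2 : ℝ) • K, (1 / 2 : ℝ) • N, 0)
  have hpat₀ : pat v₀.2.1 = N := by
    rw [hpat]
    simp only [v₀, Matrix.transpose_smul, hNsymm, ← add_smul]
    norm_num
    exact hadamard_closedAdj_eq_self hKH
  have hskew₀ : skew v₀.1 = -K := by
    rw [hskew]
    simp only [v₀, Matrix.transpose_smul, hK]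
    module
  have hT₀ : T v₀ = 0 := by
    have : T v₀ = pat v₀.2.1 + (skew v₀.1 * M - M * skew v₀.1) + (v₀.2.2 - v₀.2.2ᵀ) := rfl
    rw [this, hpat₀, hskew₀, hN]
    simp only [v₀, Matrix.transpose_zero]
    noncomm_ring
  let g : ℝ × Matrix m m ℝ × Matrix m m ℝ × Matrix m m ℝ → Matrix m m ℝ := fun z =>
    (1 / 2 : ℝ) • (skew z.2.1 * pat z.2.2.1 - pat z.2.2.1 * skew z.2.1) -
      (z.1 / 4) • (skew z.2.1 * pat z.2.2.1 * skew z.2.1)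
  have hg : ContDiff ℝ 1 g := by
    have h₁ : ContDiff ℝ 1 fun z : ℝ × Matrix m m ℝ × Matrix m m ℝ × Matrix m m ℝ =>
      skew z.2.1 := skew.contDiff.comp (by fun_prop)
    have h₂ : ContDiff ℝ 1 fun z : ℝ × Matrix m m ℝ × Matrix m m ℝ × Matrix m m ℝ =>
      pat z.2.2.1 := pat.contDiff.comp (by fun_prop)
    exact (((h₁.mul h₂).sub (h₂.mul h₁)).const_smul _).sub
      ((contDiff_fst.div_const _).smul ((h₁.mul h₂).mul h₁))
  have hP : Continuous fun z : ℝ × Matrix m m ℝ × Matrix m m ℝ × Matrix m m ℝ => pat z.2.2.1 :=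
    pat.continuous.comp (by fun_prop)
  have hA : Continuous fun z : ℝ × Matrix m m ℝ × Matrix m m ℝ × Matrix m m ℝ =>
      M + z.1 • pat z.2.2.1 := continuous_const.add (continuous_fst.smul hP)
  have hssp : ∀ᶠ z in 𝓝 ((0 : ℝ), v₀), InS H (M + z.1 • pat z.2.2.1) →
      HasSSP (M + z.1 • pat z.2.2.1) := by
    refine hA.continuousAt.eventually (p := fun B => InS H B → HasSSP B) ?_
    simpa only [zero_smul, add_zero] using eventually_hasSSP hstrong
  have hM_ne : ∀ᶠ z in 𝓝 ((0 : ℝ), v₀), ∀ i j, M i j ≠ 0 → (M + z.1 • pat z.2.2.1) i j ≠ 0 := by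
    refine eventually_all.2 fun i => eventually_all.2 fun j => ?_
    by_cases h : M i j = 0
    · simp [h]
    · refine (((continuous_matrix_entry i j).comp hA).continuousAt.eventually_ne ?_).mono
        fun z hz _ => hz
      simpa only [Function.comp_apply, zero_smul, add_zero] using h
  have hN_ne : ∀ᶠ z in 𝓝 ((0 : ℝ), v₀), ∀ i j, N i j ≠ 0 → pat z.2.2.1 i j ≠ 0 := by
    refine eventually_all.2 fun i => eventually_all.2 fun j => ?_
    by_cases h : N i j = 0
    · simp [h]
    · refine (((continuous_matrix_entry i j).comp hP).continuousAt.eventually_ne ?_).mono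
        fun z hz _ => hz
      simpa only [Function.comp_apply, hpat₀] using h
  obtain ⟨t, ⟨L, R, S⟩, ht, ⟨⟨hz₁, hz₂⟩, hz₃⟩, heq⟩ :=
    exists_ne_zero_perturbed_solution (LinearMap.toContinuousLinearMap T) hT g v₀ hg.contDiffAt
      hT₀ ((hssp.and hM_ne).and hN_ne)
  dsimp only at hz₁ hz₂ hz₃
  set P := pat R with hPR
  set J := skew L with hJL
  have hJ : Jᵀ = -J := by rw [hJL, hskew]; simp
  have hPsymm : Pᵀ = P := by
    ext i j
    rw [hPR, hpat]
    simp [Matrix.hadamard_apply, (closedAdj_isSymm H).apply, add_comm]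
  have heq' : P + (J * M - M * J) + (S - Sᵀ) +
      t • ((1 / 2 : ℝ) • (J * P - P * J) - (t / 4) • (J * P * J)) = 0 := heq
  have hmain : P + (J * M - M * J) +
      t • ((1 / 2 : ℝ) • (J * P - P * J) - (t / 4) • (J * P * J)) = 0 := by
    have htr := congrArg Matrix.transpose heq'
    simp only [Matrix.transpose_add, Matrix.transpose_sub, Matrix.transpose_smul,
      Matrix.transpose_mul, hJ, hPsymm, hM.eq, Matrix.transpose_transpose,
      Matrix.transpose_zero, neg_mul, mul_neg, neg_neg, ← mul_assoc] at htr
    have hsum := congrArg₂ (fun X Y : Matrix m m ℝ => (1 / 2 : ℝ) • (X + Y)) heq' htr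
    simp only [add_zero, smul_zero] at hsum
    rw [← hsum]
    module
  set C := (t / 2) • J with hC
  have hCt : Cᵀ = -C := by rw [hC, Matrix.transpose_smul, hJ, smul_neg]
  have hcayley : (1 + C) * (M + t • P) * (1 - C) = (1 - C) * M * (1 + C) := by
    rw [← sub_eq_zero, ← smul_zero t, ← hmain, hC]
    simp only [mul_add, add_mul, mul_sub, sub_mul, one_mul, mul_one, smul_mul_assoc,
      mul_smul_comm, smul_add, smul_sub, smul_smul]
    module
  have hpos : IsUnit (1 + C) := isUnit_one_add_of_transpose_eq_neg hCt
  have hneg : IsUnit (1 - C) := by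
    rw [sub_eq_add_neg]
    exact isUnit_one_add_of_transpose_eq_neg (by rw [Matrix.transpose_neg, hCt])
  have hAS : InS H (M + t • P) := by
    refine ⟨by rw [Matrix.IsSymm, Matrix.transpose_add, Matrix.transpose_smul, hM.eq, hPsymm],
      fun i j hij => ⟨fun h => ?_, fun h => ?_⟩⟩
    · by_contra hnadj
      have hMij : M i j = 0 := by_contra fun h' => hnadj (hMH i j hij h')
      have hPij : P i j = 0 := by
        rw [hPR, hpat]
        simp [closedAdj, Matrix.hadamard_apply, hij, hnadj]
      simp [hMij, hPij] at h
    · by_cases hMij : M i j = 0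
      · have := hz₃ i j ((hadj i j h).resolve_left (not_not.2 hMij))
        simp [hMij, ht, this]
      · exact hz₂ i j hMij
  obtain ⟨Q, hQ, hAQ⟩ := exists_isUnit_mul_eq_mul hpos hneg hcayley
  exact ⟨M + t • P, Q, hAS, hz₁ hAS, (Matrix.isUnit_iff_isUnit_det _).1 hQ, hAQ⟩

end Matrix

section Bordering

open Classical in
/-- A set of `k + 1` coordinates meeting the support of every nonzero vector of a
`k`-dimensional subspace at least twice is the support of a vector orthogonal to the subspace. -/
theorem exists_orthogonal_support_eq {ι : Type*} [Fintype ι] [DecidableEq ι]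
    (E : Submodule ℝ (ι → ℝ)) (α : Finset ι) (hcard : α.card = Module.finrank ℝ E + 1)
    (hE : ∀ x ∈ E, x ≠ 0 → 2 ≤ (α.filter fun i => x i ≠ 0).card) :
    ∃ b : ι → ℝ, (∀ i, b i ≠ 0 ↔ i ∈ α) ∧ ∀ x ∈ E, b ⬝ᵥ x = 0 := by
  let φ : (α → ℝ) →ₗ[ℝ] Module.Dual ℝ E :=
    { toFun := fun b =>
        { toFun := fun x => ∑ i : α, b i * x.1 i
          map_add' := fun x y => by simp [mul_add, Finset.sum_add_distrib]
          map_smul' := fun c x => by simp [Finset.mul_sum, mul_left_comm] }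
      map_add' := fun b c => by ext x; simp [add_mul, Finset.sum_add_distrib]
      map_smul' := fun c b => by ext x; simp [Finset.mul_sum, mul_assoc] }
  have hφ : ∀ b x, φ b x = ∑ i : α, b i * x.1 i := fun _ _ => rfl
  obtain ⟨b, hb, hb₀⟩ := φ.ker.ne_bot_iff.1 (LinearMap.ker_ne_bot_of_finrank_lt (f := φ) (by
    rw [Subspace.dual_finrank_eq, Module.finrank_fintype_fun_eq_card, Fintype.card_coe, hcard]
    omega))
  have hne : ∀ i, b i ≠ 0 := by
    intro i hi
    let ρ : E →ₗ[ℝ] ({j : α // j ≠ i} → ℝ) :=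
      { toFun := fun x j => x.1 j.1
        map_add' := fun _ _ => rfl
        map_smul' := fun _ _ => rfl }
    have hinj : Function.Injective ρ := by
      refine (injective_iff_map_eq_zero ρ).2 fun x hx => ?_
      by_contra hx₀
      have h2 := hE x.1 x.2 (fun h => hx₀ (Subtype.ext h))
      have hsub : (α.filter fun j => x.1 j ≠ 0) ⊆ {i.1} := by
        intro j hj
        rw [Finset.mem_filter] at hj
        rw [Finset.mem_singleton]
        by_contra hji
        exact hj.2 (congrFun hx ⟨⟨j, hj.1⟩, fun h => hji (congrArg Subtype.val h)⟩)
      have := Finset.card_le_card hsub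
      rw [Finset.card_singleton] at this
      omega
    have hsurj : Function.Surjective ρ :=
      (LinearMap.injective_iff_surjective_of_finrank_eq_finrank (by
        rw [Module.finrank_fintype_fun_eq_card, Fintype.card_subtype_compl, Fintype.card_coe,
          hcard]
        simp)).1 hinj
    refine hb₀ (funext fun j => ?_)
    by_cases hji : j = i
    · rw [hji, hi, Pi.zero_apply]
    obtain ⟨x, hx⟩ := hsurj (Pi.single ⟨j, hji⟩ 1)
    have hsum : ∑ l : α, b l * x.1 l = 0 := by
      rw [← hφ, LinearMap.mem_ker.1 hb, LinearMap.zero_apply]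
    rw [Finset.sum_eq_single j] at hsum
    · have hxj : x.1 j = 1 := by simpa [ρ] using congrFun hx ⟨j, hji⟩
      simpa [hxj] using hsum
    · intro l _ hlj
      by_cases hli : l = i
      · rw [hli, hi, zero_mul]
      · have hxl : x.1 l = 0 := by
          simpa [ρ, Pi.single_apply, hlj] using congrFun hx ⟨l, hli⟩
        rw [hxl, mul_zero]
    · simp
  refine ⟨fun i => if h : i ∈ α then b ⟨i, h⟩ else 0, fun i => ?_, fun x hx => ?_⟩
  · by_cases h : i ∈ α <;> simp [h, hne]
  · have h := hφ b ⟨x, hx⟩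
    rw [LinearMap.mem_ker.1 hb, LinearMap.zero_apply] at h
    rw [dotProduct, ← Finset.sum_subset (Finset.subset_univ α), ← Finset.sum_coe_sort]
    · simpa using h.symm
    · intro i _ hi
      simp [hi]

theorem exists_mulVec_eq_of_orthogonal_ker {ι : Type*} [Fintype ι] [DecidableEq ι]
    {B : Matrix ι ι ℝ} (hB : B.IsSymm) {b : ι → ℝ} (hb : ∀ x, B *ᵥ x = 0 → b ⬝ᵥ x = 0) :
    ∃ y, B *ᵥ y = b := by
  by_contra hne
  obtain ⟨f, hfb, hf⟩ := Submodule.exists_le_ker_of_notMem (p := B.mulVecLin.range) (v := b)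
    fun ⟨y, hy⟩ => hne ⟨y, hy⟩
  obtain ⟨x, rfl⟩ := (dotProductEquiv ℝ ι).surjective f
  refine hfb ?_
  rw [dotProductEquiv_apply_apply, dotProduct_comm]
  refine hb x ((dotProduct_eq_zero_iff).1 fun w => ?_)
  have := hf ⟨w, rfl⟩
  rw [LinearMap.mem_ker, dotProductEquiv_apply_apply, Matrix.mulVecLin_apply,
    Matrix.dotProduct_mulVec, ← Matrix.mulVec_transpose, hB.eq] at this
  exact this

variable {n : ℕ}

/-- The matrix with principal block `A`, last column `y`, last row `z` and last entry `c`. -/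
def bordered (A : Matrix (Fin n) (Fin n) ℝ) (y z : Fin n → ℝ) (c : ℝ) :
    Matrix (Fin (n + 1)) (Fin (n + 1)) ℝ :=
  Matrix.of (Fin.snoc (fun i => Fin.snoc (A i) (y i)) (Fin.snoc z c))

variable (A : Matrix (Fin n) (Fin n) ℝ) (y z : Fin n → ℝ) (c : ℝ)

@[simp]
theorem bordered_castSucc_castSucc (i j : Fin n) :
    bordered A y z c i.castSucc j.castSucc = A i j := by
  simp [bordered]

@[simp]
theorem bordered_castSucc_last (i : Fin n) :
    bordered A y z c i.castSucc (Fin.last n) = y i := by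
  simp [bordered]

@[simp]
theorem bordered_last_castSucc (j : Fin n) :
    bordered A y z c (Fin.last n) j.castSucc = z j := by
  simp [bordered]

@[simp]
theorem bordered_last_last : bordered A y z c (Fin.last n) (Fin.last n) = c := by
  simp [bordered]

theorem multOf_bordered_zero (t : ℝ) :
    multOf (bordered A 0 0 c) t = multOf A t + if t = c then 1 else 0 := by
  have hker : ∀ v : Fin (n + 1) → ℝ,
      (bordered A 0 0 c - t • (1 : Matrix (Fin (n + 1)) (Fin (n + 1)) ℝ)) *ᵥ v = 0 ↔
        (A - t • (1 : Matrix (Fin n) (Fin n) ℝ)) *ᵥ (fun i => v i.castSucc) = 0 ∧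
          (c - t) * v (Fin.last n) = 0 := by
    intro v
    simp [funext_iff, Fin.forall_fin_succ', Matrix.sub_mulVec, Matrix.smul_mulVec,
      Matrix.mulVec, dotProduct, Fin.sum_univ_castSucc, sub_mul]
  let e : (bordered A 0 0 c - t • (1 : Matrix _ _ ℝ)).mulVecLin.ker ≃ₗ[ℝ]
      (A - t • (1 : Matrix _ _ ℝ)).mulVecLin.ker × (LinearMap.mulLeft ℝ (c - t)).ker :=
    { toFun := fun v => (⟨fun i => v.1 i.castSucc, ((hker v.1).1 v.2).1⟩,
        ⟨v.1 (Fin.last n), ((hker v.1).1 v.2).2⟩)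
      map_add' := fun _ _ => rfl
      map_smul' := fun _ _ => rfl
      invFun := fun w => ⟨Fin.snoc w.1.1 w.2.1, (hker _).2 ⟨by
        simp only [Fin.snoc_castSucc]; exact w.1.2, by simp only [Fin.snoc_last]; exact w.2.2⟩⟩
      left_inv := fun v => by
        ext i
        induction i using Fin.lastCases <;> simp
      right_inv := fun w => by
        refine Prod.ext (Subtype.ext (funext fun i => ?_)) (Subtype.ext ?_) <;> simp }
  rw [multOf, e.finrank_eq, Module.finrank_prod, multOf]
  congr 1
  split_ifs with h
  · rw [h, sub_self, LinearMap.mulLeft_zero_eq_zero, LinearMap.ker_zero, finrank_top,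
      Module.finrank_self]
  · rw [LinearMap.ker_eq_bot.2 (mul_right_injective₀ (sub_ne_zero.2 (Ne.symm h))), finrank_bot]

end Bordering

theorem augment_adj_castSucc_castSucc {n : ℕ} (G : SimpleGraph (Fin n)) (α : Finset (Fin n))
    (i j : Fin n) : (augment G α).Adj i.castSucc j.castSucc ↔ G.Adj i j := by
  have hne := fun h : G.Adj i j => h.ne
  simp [augment, SimpleGraph.fromRel_adj, Fin.castSucc_ne_last, G.adj_comm j i]
  tauto

theorem augment_adj_castSucc_last {n : ℕ} (G : SimpleGraph (Fin n)) (α : Finset (Fin n))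
    (i : Fin n) : (augment G α).Adj i.castSucc (Fin.last n) ↔ i ∈ α := by
  simp [augment, SimpleGraph.fromRel_adj, Fin.castSucc_ne_last, (Fin.castSucc_ne_last _).symm]

/-- `A ⊕ [lam]` has the Strong Spectral Property relative to `augment G α` when no eigenvector of
`A` for `lam` vanishes on `α`. -/
theorem eq_zero_of_commute_bordered {n : ℕ} {G : SimpleGraph (Fin n)}
    {A : Matrix (Fin n) (Fin n) ℝ} (hA : InS G A) (hssp : HasSSP A) {lam : ℝ}
    {α : Finset (Fin n)}
    (hα : ∀ x : Fin n → ℝ, A *ᵥ x = lam • x → (∀ i ∈ α, x i = 0) → x = 0)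
    {X : Matrix (Fin (n + 1)) (Fin (n + 1)) ℝ} (hX : X.IsSymm)
    (hpat : closedAdj (augment G α) ⊙ X = 0)
    (hcomm : bordered A 0 0 lam * X = X * bordered A 0 0 lam) : X = 0 := by
  obtain ⟨hadj, hdiag⟩ := hadamard_closedAdj_eq_zero_iff.1 hpat
  have hblock : X.submatrix Fin.castSucc Fin.castSucc = 0 := by
    refine hssp _ (hX.submatrix _) ?_ ?_ (sub_eq_zero.2 ?_)
    · ext i j
      rw [Matrix.hadamard_apply, Matrix.submatrix_apply, Matrix.zero_apply]
      by_cases hij : i = j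
      · rw [hij, hdiag, mul_zero]
      · by_cases h : A i j = 0
        · rw [h, zero_mul]
        · rw [hadj _ _ ((augment_adj_castSucc_castSucc G α i j).2 ((hA.2 i j hij).1 h)), mul_zero]
    · ext i j
      by_cases hij : i = j
      · simp [hij, hdiag]
      · simp [hij]
    · ext i j
      simpa [Matrix.mul_apply, Fin.sum_univ_castSucc] using
        congrFun₂ hcomm i.castSucc j.castSucc
  have hcol : (fun i : Fin n => X i.castSucc (Fin.last n)) = 0 := by
    refine hα _ (funext fun i => ?_) fun i hi =>
      hadj _ _ ((augment_adj_castSucc_last G α i).2 hi)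
    simpa [Matrix.mul_apply, Fin.sum_univ_castSucc, Matrix.mulVec, dotProduct, mul_comm lam] using
      congrFun₂ hcomm i.castSucc (Fin.last n)
  ext i j
  induction i using Fin.lastCases with
  | last =>
    induction j using Fin.lastCases with
    | last => exact hdiag _
    | cast j => rw [← hX.apply]; exact congrFun hcol j
  | cast i =>
    induction j using Fin.lastCases with
    | last => exact congrFun hcol i
    | cast j => exact congrFun₂ hblock i j

/-- Augmentation Lemma: let `A ∈ S(G)` have the SSP, let `lam` be an eigenvalue
of `A` of multiplicity `k ≥ 1`, and let `α` be a set of `k + 1` vertices meeting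
the support of every eigenvector of `A` for `lam` in at least two indices.  Then
there is an SSP matrix `A' ∈ S(H)`, where `H` appends a new vertex adjacent
exactly to `α`, with the multiplicity of `lam` increased to `k + 1` and all
other eigenvalues and multiplicities unchanged. -/
theorem augmentation_SSP {n : ℕ} (G : SimpleGraph (Fin n))
    (A : Matrix (Fin n) (Fin n) ℝ) (hA : InS G A) (hssp : HasSSP A)
    (lam : ℝ) (k : ℕ) (hk : 1 ≤ k) (hmult : multOf A lam = k)
    (α : Finset (Fin n)) (hcard : α.card = k + 1)
    (hsupp : ∀ x : Fin n → ℝ, x ≠ 0 → A.mulVec x = lam • x →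
      2 ≤ (α.filter fun i => x i ≠ 0).card) :
    ∃ A' : Matrix (Fin (n + 1)) (Fin (n + 1)) ℝ,
      InS (augment G α) A' ∧ HasSSP A' ∧
      multOf A' lam = k + 1 ∧ ∀ t : ℝ, t ≠ lam → multOf A' t = multOf A t := by
  have heig : ∀ x : Fin n → ℝ, (A - lam • (1 : Matrix (Fin n) (Fin n) ℝ)) *ᵥ x = 0 ↔
      A *ᵥ x = lam • x := fun x => by
    rw [Matrix.sub_mulVec, Matrix.smul_mulVec, Matrix.one_mulVec, sub_eq_zero]
  have hα : ∀ x : Fin n → ℝ, A *ᵥ x = lam • x → (∀ i ∈ α, x i = 0) → x = 0 := by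
    intro x hx hzero
    by_contra hne
    have h2 := hsupp x hne hx
    rw [Finset.filter_false_of_mem fun i hi => not_not.2 (hzero i hi)] at h2
    simp at h2
  obtain ⟨b, hbα, hb⟩ := exists_orthogonal_support_eq
    (A - lam • (1 : Matrix (Fin n) (Fin n) ℝ)).mulVecLin.ker α (by rw [hcard, ← hmult]; rfl)
    fun x hx hne => by convert hsupp x hne ((heig x).1 hx)
  have hBsymm : (A - lam • (1 : Matrix (Fin n) (Fin n) ℝ)).IsSymm :=
    hA.1.sub (Matrix.isSymm_one.smul lam)
  obtain ⟨y, hy⟩ := exists_mulVec_eq_of_orthogonal_ker hBsymm fun x hx => hb x hx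
  rw [Matrix.sub_mulVec, Matrix.smul_mulVec, Matrix.one_mulVec] at hy
  have hM : (bordered A 0 0 lam).IsSymm := by
    ext i j
    induction i using Fin.lastCases <;> induction j using Fin.lastCases <;> simp [hA.1.apply]
  have hK : (bordered 0 (-y) y 0)ᵀ = -bordered 0 (-y) y 0 := by
    ext i j
    induction i using Fin.lastCases <;> induction j using Fin.lastCases <;> simp
  have hN : bordered 0 (-y) y 0 * bordered A 0 0 lam -
      bordered A 0 0 lam * bordered 0 (-y) y 0 = bordered 0 b b 0 := by
    have hyi : ∀ i, ∑ l, A i l * y l - lam * y i = b i := fun i => congrFun hy i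
    ext i j
    induction i using Fin.lastCases <;> induction j using Fin.lastCases <;>
      simp [Matrix.mul_apply, Fin.sum_univ_castSucc, ← hyi, mul_comm (y _), hA.1.apply]
    abel
  have hMH : ∀ i j, i ≠ j → bordered A 0 0 lam i j ≠ 0 → (augment G α).Adj i j := by
    intro i j hij h
    induction i using Fin.lastCases <;> induction j using Fin.lastCases <;> simp at h hij
    rw [augment_adj_castSucc_castSucc, ← hA.2 _ _ hij]
    exact h
  have hNH : ∀ i j, i ≠ j → bordered 0 b b 0 i j ≠ 0 → (augment G α).Adj i j := by
    intro i j hij h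
    induction i using Fin.lastCases <;> induction j using Fin.lastCases <;> simp at h
    · rwa [SimpleGraph.adj_comm, augment_adj_castSucc_last, ← hbα]
    · rwa [augment_adj_castSucc_last, ← hbα]
  have hadj : ∀ i j, (augment G α).Adj i j →
      bordered A 0 0 lam i j ≠ 0 ∨ bordered 0 b b 0 i j ≠ 0 := by
    intro i j h
    induction i using Fin.lastCases <;> induction j using Fin.lastCases
    · exact absurd rfl h.ne
    · rw [SimpleGraph.adj_comm, augment_adj_castSucc_last, ← hbα] at h
      simp [h]
    · rw [augment_adj_castSucc_last, ← hbα] at h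
      simp [h]
    · rw [augment_adj_castSucc_castSucc] at h
      exact Or.inl (by simpa using (hA.2 _ _ h.ne).2 h)
  rw [← hN] at hNH hadj
  obtain ⟨A', Q, hA', hssp', hQ, hAQ⟩ := exists_similar_hasSSP hM hMH
    (fun X => eq_zero_of_commute_bordered hA hssp hα) hK hNH hadj
  refine ⟨A', hA', hssp', ?_, fun t ht => ?_⟩
  · rw [multOf_eq_of_mul_eq_mul hQ hAQ, multOf_bordered_zero, hmult, if_pos rfl]
  · rw [multOf_eq_of_mul_eq_mul hQ hAQ, multOf_bordered_zero, if_neg ht, add_zero]
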